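/- Sign coincidence and sign difference of Y_ν and Y_{ν+1} between consecutive zeros: for every real ν ≥ 0 and every integer s ≥ 1, Y_ν(x)·Y_{ν+1}(x) > 0 for every x in the open interval (y_{ν+1,s}, y_{ν,s+1}), and Y_ν(x)·Y_{ν+1}(x) < 0 for every x in the open interval (y_{ν,s}, y_{ν+1,s}). -/

import Mathlib

open Real Filter

/-- Bessel function of the first kind of real order `ν`:
`J_ν(x) = Σ_{k=0}^∞ ((−1)^k / (k! · Γ(ν+k+1))) · (x/2)^{ν+2k}`. -/
noncomputable def besselJ (ν : ℝ) (x : ℝ) : ℝ :=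
  ∑' k : ℕ, ((-1 : ℝ) ^ k / ((k.factorial : ℝ) * Real.Gamma (ν + k + 1))) *
    (x / 2) ^ (ν + 2 * (k : ℝ))

/-- Bessel function of the second kind of real order `ν`, defined as the limit
`Y_ν(x) = lim_{μ→ν, μ ∉ ℤ} (J_μ(x)·cos(μπ) − J_{−μ}(x)) / sin(μπ)`. -/
noncomputable def besselY (ν : ℝ) (x : ℝ) : ℝ :=
  limUnder (nhdsWithin ν {μ : ℝ | ∀ n : ℤ, μ ≠ (n : ℝ)})
    fun μ => (besselJ μ x * Real.cos (μ * π) - besselJ (-μ) x) / Real.sin (μ * π)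

/-- `z s`, for integers `s ≥ 1`, enumerates all the positive real zeros of `f`
in strictly increasing order. -/
structure IsPosZeroSeq (f : ℝ → ℝ) (z : ℕ → ℝ) : Prop where
  pos : ∀ s, 1 ≤ s → 0 < z s
  mono : ∀ s t, 1 ≤ s → s < t → z s < z t
  isZero : ∀ s, 1 ≤ s → f (z s) = 0
  complete : ∀ x, 0 < x → f x = 0 → ∃ s, 1 ≤ s ∧ z s = x

/-- `z s`, for integers `s ≥ 1`, enumerates the zeros `j'_{ν,s}` of `J'_ν`
(increasingly), with the convention that `x = 0` is counted as the first zero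
`j'_{0,1}` of `J'_0`. -/
def IsBesselJDerivZeroSeq (ν : ℝ) (z : ℕ → ℝ) : Prop :=
  (ν = 0 → z 1 = 0 ∧ IsPosZeroSeq (deriv (besselJ 0)) fun s => z (s + 1)) ∧
  (ν ≠ 0 → IsPosZeroSeq (deriv (besselJ ν)) z)

open Topology

/-- The reciprocal of the real Gamma function. -/
noncomputable def rGamma (z : ℝ) : ℝ := (Real.Gamma z)⁻¹

theorem contDiff_rGamma : ContDiff ℝ 1 rGamma := by
  have h : ContDiff ℂ 1 (fun s : ℂ => (Complex.Gamma s)⁻¹) :=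
    Complex.differentiable_one_div_Gamma.contDiff
  have e : rGamma = fun x : ℝ => ((Complex.Gamma x)⁻¹).re := by
    funext x
    rw [Complex.Gamma_ofReal, ← Complex.ofReal_inv, Complex.ofReal_re, rGamma]
  rw [e]
  exact h.real_of_complex

theorem hasDerivAt_rGamma (z : ℝ) : HasDerivAt rGamma (deriv rGamma z) z :=
  (contDiff_rGamma.differentiable one_ne_zero z).hasDerivAt

theorem rGamma_eq_mul (z : ℝ) : rGamma z = z * rGamma (z + 1) := by
  unfold rGamma
  rcases eq_or_ne z 0 with rfl | hz
  · simp
  · rw [Real.Gamma_add_one hz, mul_inv, mul_inv_cancel_left₀ hz]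

theorem deriv_rGamma_eq (z : ℝ) :
    deriv rGamma z = rGamma (z + 1) + z * deriv rGamma (z + 1) := by
  have h1 : HasDerivAt (fun z => z * rGamma (z + 1))
      (1 * rGamma (z + 1) + z * deriv rGamma (z + 1)) z :=
    (hasDerivAt_id z).mul ((hasDerivAt_rGamma (z + 1)).comp_add_const z 1)
  rw [← funext rGamma_eq_mul] at h1
  rw [h1.deriv, one_mul]

/-- A function bounded on every half-line `[R, ∞)`. -/
def BoundedOnRays (h : ℝ → ℝ) : Prop := ∀ R : ℝ, ∃ M, ∀ z, R ≤ z → |h z| ≤ M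

theorem exists_bound_rGamma (R : ℝ) :
    ∃ M, ∀ z, R ≤ z → |rGamma z| ≤ M ∧ |deriv rGamma z| ≤ M := by
  obtain ⟨M₁, h₁⟩ := (isCompact_Icc (a := R) (b := max R 3)).exists_bound_of_continuousOn
    contDiff_rGamma.continuous.continuousOn
  obtain ⟨M₂, h₂⟩ := (isCompact_Icc (a := R) (b := max R 3)).exists_bound_of_continuousOn
    (contDiff_rGamma.continuous_deriv le_rfl).continuousOn
  obtain ⟨M₃, h₃⟩ := (isCompact_Icc (a := (2 : ℝ)) (b := 3)).exists_bound_of_continuousOn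
    contDiff_rGamma.continuous.continuousOn
  obtain ⟨M₄, h₄⟩ := (isCompact_Icc (a := (2 : ℝ)) (b := 3)).exists_bound_of_continuousOn
    (contDiff_rGamma.continuous_deriv le_rfl).continuousOn
  simp only [Real.norm_eq_abs] at h₁ h₂ h₃ h₄
  have step : ∀ (n : ℕ) (z : ℝ), 2 ≤ z → z ≤ 3 + n →
      |rGamma z| ≤ max M₃ M₄ ∧ |deriv rGamma z| ≤ max M₃ M₄ := by
    intro n
    induction n with
    | zero =>
      intro z hz hz'
      have hz'' : z ∈ Set.Icc (2 : ℝ) 3 := ⟨hz, by simpa using hz'⟩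
      exact ⟨(h₃ z hz'').trans (le_max_left _ _), (h₄ z hz'').trans (le_max_right _ _)⟩
    | succ n ih =>
      intro z hz hz'
      push_cast at hz'
      rcases le_total z 3 with h3 | h3
      · exact ih z hz (by linarith [(Nat.cast_nonneg n : (0 : ℝ) ≤ n)])
      obtain ⟨ha, hb⟩ := ih (z - 1) (by linarith) (by linarith)
      have e1 := rGamma_eq_mul (z - 1)
      have e2 := deriv_rGamma_eq (z - 1)
      rw [sub_add_cancel] at e1 e2
      have k1 : (z - 1) * |rGamma z| ≤ max M₃ M₄ := by
        rwa [e1, abs_mul, abs_of_pos (by linarith : 0 < z - 1)] at ha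
      have k2 : (z - 1) * |deriv rGamma z| ≤ max M₃ M₄ + |rGamma z| := by
        have : (z - 1) * deriv rGamma z = deriv rGamma (z - 1) - rGamma z := by linarith
        rw [← abs_of_pos (by linarith : 0 < z - 1), ← abs_mul, this]
        exact (abs_sub _ _).trans (by linarith)
      constructor <;> nlinarith [abs_nonneg (rGamma z), abs_nonneg (deriv rGamma z)]
  refine ⟨max (max M₁ M₂) (max M₃ M₄), fun z hz => ?_⟩
  rcases le_total z (max R 3) with h | h
  · exact ⟨(h₁ z ⟨hz, h⟩).trans ((le_max_left _ _).trans (le_max_left _ _)),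
      (h₂ z ⟨hz, h⟩).trans ((le_max_right _ _).trans (le_max_left _ _))⟩
  · obtain ⟨n, hn⟩ := exists_nat_ge z
    have := step n z (by linarith [le_max_right R 3]) (by linarith)
    exact ⟨this.1.trans (le_max_right _ _), this.2.trans (le_max_right _ _)⟩

theorem boundedOnRays_rGamma : BoundedOnRays rGamma := fun R =>
  (exists_bound_rGamma R).imp fun _ h z hz => (h z hz).1

theorem boundedOnRays_deriv_rGamma : BoundedOnRays (deriv rGamma) := fun R =>
  (exists_bound_rGamma R).imp fun _ h z hz => (h z hz).2

/-- The series `∑ (-t)^k / k! * h (a + k)`; for `h = 1 / Γ` it is a regularized `₀F₁`. -/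
noncomputable def besselSeries (h : ℝ → ℝ) (a t : ℝ) : ℝ :=
  ∑' k : ℕ, (-t) ^ k / (k.factorial : ℝ) * h (a + k)

theorem norm_besselSeries_term_le {h : ℝ → ℝ} {R M T : ℝ} (hM : ∀ z, R ≤ z → |h z| ≤ M) {a t : ℝ}
    (ha : R ≤ a) (ht : |t| ≤ T) (k : ℕ) :
    ‖(-t) ^ k / (k.factorial : ℝ) * h (a + k)‖ ≤ T ^ k / (k.factorial : ℝ) * M := by
  have hk : (0 : ℝ) ≤ k := k.cast_nonneg
  rw [norm_mul, norm_div, norm_pow, norm_neg, Real.norm_eq_abs, Real.norm_eq_abs,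
    Real.norm_eq_abs, abs_of_nonneg (k.factorial.cast_nonneg' (α := ℝ))]
  have := hM (a + k) (by linarith)
  have h0 : 0 ≤ T := (abs_nonneg t).trans ht
  gcongr

theorem summable_besselSeries {h : ℝ → ℝ} (hb : BoundedOnRays h) (a t : ℝ) :
    Summable fun k : ℕ => (-t) ^ k / (k.factorial : ℝ) * h (a + k) := by
  obtain ⟨M, hM⟩ := hb a
  exact Summable.of_norm_bounded ((Real.summable_pow_div_factorial |t|).mul_right M)
    (norm_besselSeries_term_le hM le_rfl le_rfl)

theorem hasDerivAt_besselSeries_order {h h' : ℝ → ℝ} (hb : BoundedOnRays h)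
    (hb' : BoundedOnRays h') (hd : ∀ z, HasDerivAt h (h' z) z) (a t : ℝ) :
    HasDerivAt (fun a => besselSeries h a t) (besselSeries h' a t) a := by
  obtain ⟨M, hM⟩ := hb' (a - 1)
  refine hasDerivAt_tsum_of_isPreconnected
    (g := fun (k : ℕ) a => (-t) ^ k / (k.factorial : ℝ) * h (a + k))
    (g' := fun (k : ℕ) a => (-t) ^ k / (k.factorial : ℝ) * h' (a + k))
    ((Real.summable_pow_div_factorial |t|).mul_right M)
    (isOpen_Ioi (a := a - 1)) isPreconnected_Ioi (fun k y _ => ?_)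
    (fun k y hy => norm_besselSeries_term_le hM (le_of_lt hy) le_rfl k)
    (Set.mem_Ioi.2 (sub_one_lt a)) (summable_besselSeries hb a t) (Set.mem_Ioi.2 (sub_one_lt a))
  exact ((hd (y + k)).comp_add_const y k).const_mul _

theorem hasDerivAt_besselSeries {h : ℝ → ℝ} (hb : BoundedOnRays h) (a t : ℝ) :
    HasDerivAt (besselSeries h a) (-besselSeries h (a + 1) t) t := by
  obtain ⟨M, hM⟩ := hb a
  have key : ∀ (k : ℕ) (y : ℝ), ((k + 1 : ℕ) : ℝ) * (-y) ^ k / ((k + 1).factorial : ℝ)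
      = (-y) ^ k / (k.factorial : ℝ) := by
    intro k y
    rw [Nat.factorial_succ, Nat.cast_mul]
    exact mul_div_mul_left _ _ (by positivity)
  have hs : Summable fun k : ℕ => (|t| + 1) ^ (k - 1) * k / (k.factorial : ℝ) * M := by
    refine Summable.mul_right M ((summable_nat_add_iff 1).1 ?_)
    refine (Real.summable_pow_div_factorial (|t| + 1)).congr fun k => ?_
    symm
    rw [Nat.factorial_succ, Nat.cast_mul, Nat.add_sub_cancel, mul_comm]
    exact mul_div_mul_left _ _ (by positivity)
  have hmem : t ∈ Set.Ioo (-(|t| + 1)) (|t| + 1) :=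
    abs_lt.1 (lt_add_one |t|)
  have main := hasDerivAt_tsum_of_isPreconnected
    (g := fun (k : ℕ) t => (-t) ^ k / (k.factorial : ℝ) * h (a + k))
    (g' := fun (k : ℕ) t => (k * (-t) ^ (k - 1) * -1) / (k.factorial : ℝ) * h (a + k))
    hs isOpen_Ioo isPreconnected_Ioo
    (fun k y _ => (((hasDerivAt_id y).neg.pow k).div_const _).mul_const _)
    (fun k y hy => ?_) hmem (summable_besselSeries hb a t) hmem
  · refine main.congr_deriv ?_
    have hsum : Summable fun k : ℕ =>
        (k * (-t) ^ (k - 1) * -1) / (k.factorial : ℝ) * h (a + k) := by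
      refine (summable_nat_add_iff 1).1 ?_
      refine (summable_congr fun k => ?_).2 (summable_besselSeries hb (a + 1) t).neg
      rw [Nat.add_sub_cancel, mul_neg_one, neg_div, key, neg_mul]
      push_cast
      rw [add_assoc, add_comm (k : ℝ) 1]
    rw [hsum.tsum_eq_zero_add, besselSeries, ← tsum_neg]
    simp only [Nat.cast_zero, zero_mul, zero_div, zero_add]
    refine tsum_congr fun k => ?_
    rw [Nat.add_sub_cancel, mul_neg_one, neg_div, key, neg_mul]
    push_cast
    rw [add_assoc, add_comm (k : ℝ) 1]
  · have hy' : |y| ≤ |t| + 1 := (abs_lt.2 hy).le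
    have h2 := hM (a + k) (by linarith [(Nat.cast_nonneg k : (0 : ℝ) ≤ k)])
    rw [norm_mul, norm_div, norm_mul, norm_mul, norm_pow, norm_neg, norm_neg, norm_one, mul_one,
      mul_comm (‖(k : ℝ)‖), Real.norm_eq_abs, Real.norm_eq_abs, Real.norm_eq_abs,
      Real.norm_eq_abs, abs_of_nonneg (k.factorial.cast_nonneg' (α := ℝ)),
      abs_of_nonneg (k.cast_nonneg' (α := ℝ))]
    gcongr

theorem besselSeries_rGamma_zero (a : ℝ) : besselSeries rGamma a 0 = rGamma a := by
  rw [besselSeries, tsum_eq_single 0]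
  · simp
  · intro k hk
    simp [hk]

theorem besselSeries_rGamma_recurrence (a t : ℝ) :
    besselSeries rGamma a t
      = a * besselSeries rGamma (a + 1) t - t * besselSeries rGamma (a + 2) t := by
  have h1 := summable_besselSeries boundedOnRays_rGamma (a + 1) t
  have h2 := summable_besselSeries boundedOnRays_rGamma (a + 2) t
  have hA : HasSum (fun k : ℕ => k * ((-t) ^ k / (k.factorial : ℝ) * rGamma (a + 1 + k)))
      (-t * besselSeries rGamma (a + 2) t) := by
    have h3 : HasSum (fun k : ℕ => -t * ((-t) ^ k / (k.factorial : ℝ) * rGamma (a + 2 + k)))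
      (-t * besselSeries rGamma (a + 2) t) := h2.hasSum.mul_left _
    rw [← hasSum_nat_add_iff' 1]
    simp only [Finset.sum_range_one, Nat.cast_zero, zero_mul, sub_zero]
    refine (congrArg (HasSum · _) (funext fun k => ?_)).mpr h3
    rw [Nat.factorial_succ]
    push_cast
    rw [show a + 1 + ((k : ℝ) + 1) = a + 2 + k by ring]
    field_simp
    ring
  have hB : HasSum (fun k : ℕ => (-t) ^ k / (k.factorial : ℝ) * rGamma (a + k))
      (a * besselSeries rGamma (a + 1) t + -t * besselSeries rGamma (a + 2) t) := by
    refine (congrArg (HasSum · _) (funext fun k => ?_)).mpr ((h1.hasSum.mul_left a).add hA)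
    rw [rGamma_eq_mul (a + k), add_right_comm a k 1]
    ring
  rw [besselSeries, hB.tsum_eq]
  ring

theorem besselJ_eq {x : ℝ} (hx : 0 < x) (μ : ℝ) :
    besselJ μ x = (x / 2) ^ μ * besselSeries rGamma (μ + 1) (x ^ 2 / 4) := by
  rw [besselJ, besselSeries, ← tsum_mul_left]
  refine tsum_congr fun k => ?_
  have : (x / 2) ^ (2 * (k : ℝ)) = (x ^ 2 / 4) ^ k := by
    rw [Real.rpow_mul (by positivity), Real.rpow_natCast]
    congr 1
    rw [Real.rpow_ofNat]
    ring
  rw [Real.rpow_add (by positivity), this, neg_pow (x ^ 2 / 4), rGamma, add_right_comm μ 1,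
    div_eq_mul_inv, div_eq_mul_inv, mul_inv]
  ring

/-- The derivative of `besselJ μ x` with respect to the order `μ`. -/
noncomputable def besselJOrderDeriv (μ x : ℝ) : ℝ :=
  Real.log (x / 2) * besselJ μ x
    + (x / 2) ^ μ * besselSeries (deriv rGamma) (μ + 1) (x ^ 2 / 4)

theorem hasDerivAt_besselJ_order {x : ℝ} (hx : 0 < x) (μ : ℝ) :
    HasDerivAt (fun μ => besselJ μ x) (besselJOrderDeriv μ x) μ := by
  have h1 : HasDerivAt (fun μ : ℝ => (x / 2) ^ μ) ((x / 2) ^ μ * Real.log (x / 2)) μ :=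
    (Real.hasStrictDerivAt_const_rpow (by positivity) μ).hasDerivAt
  have h2 := (hasDerivAt_besselSeries_order boundedOnRays_rGamma boundedOnRays_deriv_rGamma
    hasDerivAt_rGamma (μ + 1) (x ^ 2 / 4)).comp_add_const μ 1
  rw [funext (besselJ_eq hx)]
  refine (h1.mul h2).congr_deriv ?_
  rw [besselJOrderDeriv, besselJ_eq hx]
  ring

theorem hasDerivAt_rpow_mul_besselSeries {h : ℝ → ℝ} (hb : BoundedOnRays h) {x : ℝ} (hx : 0 < x)
    (μ : ℝ) :
    HasDerivAt (fun x : ℝ => (x / 2) ^ μ * besselSeries h (μ + 1) (x ^ 2 / 4))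
      (μ / x * ((x / 2) ^ μ * besselSeries h (μ + 1) (x ^ 2 / 4))
        - (x / 2) ^ (μ + 1) * besselSeries h (μ + 1 + 1) (x ^ 2 / 4)) x := by
  have h1 : HasDerivAt (fun x : ℝ => (x / 2) ^ μ) (1 / 2 * μ * (x / 2) ^ (μ - 1)) x :=
    ((hasDerivAt_id x).div_const 2).rpow_const (Or.inl (by simpa using hx.ne'))
  have h2 : HasDerivAt (fun x : ℝ => x ^ 2 / 4) (x / 2) x := by
    refine ((hasDerivAt_pow 2 x).div_const 4).congr_deriv ?_
    norm_num
    ring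
  have h3 := (hasDerivAt_besselSeries hb (μ + 1) (x ^ 2 / 4)).comp x h2
  refine (h1.mul h3).congr_deriv ?_
  have hx2 : 0 < x / 2 := by positivity
  rw [Real.rpow_sub_one hx2.ne', Real.rpow_add_one hx2.ne']
  simp only [Function.comp_apply]
  field_simp
  ring

theorem hasDerivAt_besselJ {x : ℝ} (hx : 0 < x) (μ : ℝ) :
    HasDerivAt (besselJ μ) (μ / x * besselJ μ x - besselJ (μ + 1) x) x := by
  rw [besselJ_eq hx, besselJ_eq hx]
  refine (hasDerivAt_rpow_mul_besselSeries boundedOnRays_rGamma hx μ).congr_of_eventuallyEq ?_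
  filter_upwards [lt_mem_nhds hx] with y hy using besselJ_eq hy μ

theorem hasDerivAt_besselJOrderDeriv {x : ℝ} (hx : 0 < x) (μ : ℝ) :
    HasDerivAt (besselJOrderDeriv μ)
      (μ / x * besselJOrderDeriv μ x + besselJ μ x / x - besselJOrderDeriv (μ + 1) x) x := by
  have h1 : HasDerivAt (fun x : ℝ => Real.log (x / 2)) (1 / 2 / (x / 2)) x :=
    ((hasDerivAt_id x).div_const 2).log (by simpa using hx.ne')
  refine ((h1.mul (hasDerivAt_besselJ hx μ)).add
    (hasDerivAt_rpow_mul_besselSeries boundedOnRays_deriv_rGamma hx μ)).congr_deriv ?_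
  rw [besselJOrderDeriv, besselJOrderDeriv]
  field_simp
  ring

theorem besselJ_recurrence {x : ℝ} (hx : 0 < x) (μ : ℝ) :
    besselJ (μ - 1) x + besselJ (μ + 1) x = 2 * μ / x * besselJ μ x := by
  have hx2 : 0 < x / 2 := by positivity
  rw [besselJ_eq hx, besselJ_eq hx, besselJ_eq hx, sub_add_cancel,
    besselSeries_rGamma_recurrence μ, Real.rpow_sub_one hx2.ne', Real.rpow_add_one hx2.ne',
    show μ + 1 + 1 = μ + 2 by ring]
  field_simp
  ring

theorem besselJOrderDeriv_recurrence {x : ℝ} (hx : 0 < x) (μ : ℝ) :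
    besselJOrderDeriv (μ - 1) x + besselJOrderDeriv (μ + 1) x
      = 2 * μ / x * besselJOrderDeriv μ x + 2 / x * besselJ μ x := by
  have h1 := ((hasDerivAt_besselJ_order hx (μ - 1)).comp_sub_const μ 1).add
    ((hasDerivAt_besselJ_order hx (μ + 1)).comp_add_const μ 1)
  have h2 : HasDerivAt (fun μ : ℝ => 2 * μ / x) (2 / x) μ := by
    simpa using ((hasDerivAt_id μ).const_mul 2).div_const x
  have h3 := h2.mul (hasDerivAt_besselJ_order hx μ)
  have e : (fun μ => besselJ (μ - 1) x + besselJ (μ + 1) x)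
      = fun μ => 2 * μ / x * besselJ μ x := funext (besselJ_recurrence hx)
  have h4 := h1.unique (h3.congr_of_eventuallyEq (Eventually.of_forall (congrFun e)))
  linarith

theorem besselSeries_rGamma_wronskian (a t : ℝ) :
    besselSeries rGamma a t * besselSeries rGamma (1 - a) t
      + t * (besselSeries rGamma (a + 1) t * besselSeries rGamma (2 - a) t)
      = Real.sin (π * a) / π := by
  have hd : ∀ t, HasDerivAt (fun t => besselSeries rGamma a t * besselSeries rGamma (1 - a) t
      + t * (besselSeries rGamma (a + 1) t * besselSeries rGamma (2 - a) t)) 0 t := by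
    intro t
    have h := fun c => hasDerivAt_besselSeries boundedOnRays_rGamma c t
    refine (((h a).mul (h (1 - a))).add
      ((hasDerivAt_id t).mul ((h (a + 1)).mul (h (2 - a))))).congr_deriv ?_
    have e1 := besselSeries_rGamma_recurrence a t
    have e2 := besselSeries_rGamma_recurrence (1 - a) t
    rw [show 1 - a + 1 = 2 - a by ring, show 1 - a + 2 = 3 - a by ring] at e2
    rw [show 1 - a + 1 = 2 - a by ring, show 2 - a + 1 = 3 - a by ring,
      show a + 1 + 1 = a + 2 by ring, e1, e2, id]
    simp only [Pi.mul_apply]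
    ring
  have hconst := is_const_of_deriv_eq_zero (fun t => (hd t).differentiableAt)
    (fun t => (hd t).deriv) t 0
  rw [hconst, besselSeries_rGamma_zero, besselSeries_rGamma_zero, zero_mul, add_zero, rGamma,
    rGamma, ← mul_inv, Real.Gamma_mul_Gamma_one_sub, inv_div]

theorem besselJ_cross_product {x : ℝ} (hx : 0 < x) (μ : ℝ) :
    besselJ μ x * besselJ (-(μ + 1)) x + besselJ (μ + 1) x * besselJ (-μ) x
      = -(2 * Real.sin (μ * π)) / (π * x) := by
  have hx2 : 0 < x / 2 := by positivity
  have h := besselSeries_rGamma_wronskian (μ + 1) (x ^ 2 / 4)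
  rw [show π * (μ + 1) = μ * π + π by ring, Real.sin_add_pi] at h
  simp only [besselJ_eq hx]
  rw [Real.rpow_neg hx2.le, Real.rpow_neg hx2.le, Real.rpow_add_one hx2.ne',
    show -(μ + 1) + 1 = 1 - (μ + 1) by ring, show -μ + 1 = 2 - (μ + 1) by ring]
  have hpos : 0 < (x / 2) ^ μ := Real.rpow_pos_of_pos hx2 μ
  rw [show -(2 * Real.sin (μ * π)) / (π * x) = 2 / x * (-Real.sin (μ * π) / π) by field_simp, ← h]
  field_simp
  ring

theorem besselJ_neg_nat {x : ℝ} (hx : 0 < x) (n : ℕ) :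
    besselJ (-n) x = Real.cos (n * π) * besselJ n x := by
  induction n using Nat.twoStepInduction with
  | zero => simp
  | one =>
    have := besselJ_recurrence hx 0
    simp only [zero_sub, zero_add, mul_zero, zero_div, zero_mul] at this
    simp only [Nat.cast_one, one_mul, Real.cos_pi]
    linarith
  | more n h1 h2 =>
    have e1 := besselJ_recurrence hx (n + 1)
    have e2 := besselJ_recurrence hx (-(n + 1))
    push_cast at h1 h2 ⊢
    rw [show (n : ℝ) + 1 - 1 = n by ring, show (n : ℝ) + 1 + 1 = n + 2 by ring] at e1
    rw [show -((n : ℝ) + 1) - 1 = -(n + 2) by ring, show -((n : ℝ) + 1) + 1 = -n by ring,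
      h1, h2] at e2
    rw [show ((n : ℝ) + 2) * π = n * π + 2 * π by ring, Real.cos_add_two_pi]
    rw [show ((n : ℝ) + 1) * π = n * π + π by ring, Real.cos_add_pi] at e2
    linear_combination e2 - Real.cos (n * π) * e1

/-- The set of non-integer real numbers. -/
def nonIntegers : Set ℝ := {μ : ℝ | ∀ n : ℤ, μ ≠ (n : ℝ)}

theorem neBot_nhdsWithin_nonIntegers (ν : ℝ) : (𝓝[nonIntegers] ν).NeBot := by
  have h : nonIntegers = (Set.range ((↑) : ℤ → ℝ))ᶜ := by
    ext μ
    simp [nonIntegers, eq_comm]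
  rw [← mem_closure_iff_nhdsWithin_neBot, h]
  exact (Set.countable_range _).dense_compl ℝ ν

theorem sin_mul_pi_ne_zero {μ : ℝ} (hμ : μ ∈ nonIntegers) : Real.sin (μ * π) ≠ 0 := by
  intro h
  obtain ⟨n, hn⟩ := Real.sin_eq_zero_iff.1 h
  exact hμ n (mul_right_cancel₀ Real.pi_ne_zero hn).symm

theorem add_one_mem_nonIntegers {μ : ℝ} (hμ : μ ∈ nonIntegers) : μ + 1 ∈ nonIntegers := by
  intro n hn
  exact hμ (n - 1) (by push_cast; linarith)

theorem tendsto_add_one_nonIntegers (ν : ℝ) :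
    Tendsto (fun μ : ℝ => μ + 1) (𝓝[nonIntegers] ν) (𝓝[nonIntegers] (ν + 1)) :=
  tendsto_nhdsWithin_iff.2 ⟨((continuous_add_const 1).tendsto ν).mono_left nhdsWithin_le_nhds,
    eventually_nhdsWithin_of_forall fun _ => add_one_mem_nonIntegers⟩

/-- The quotient defining `Y_μ(x)` for non-integer `μ`. -/
noncomputable def besselYQuot (μ x : ℝ) : ℝ :=
  (besselJ μ x * Real.cos (μ * π) - besselJ (-μ) x) / Real.sin (μ * π)

theorem besselY_eq_of_tendsto {ν x l : ℝ}
    (h : Tendsto (fun μ => besselYQuot μ x) (𝓝[nonIntegers] ν) (𝓝 l)) : besselY ν x = l := by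
  have := neBot_nhdsWithin_nonIntegers ν
  exact h.limUnder_eq

theorem hasDerivAt_besselYQuot_num {x : ℝ} (hx : 0 < x) (μ : ℝ) :
    HasDerivAt (fun μ => besselJ μ x * Real.cos (μ * π) - besselJ (-μ) x)
      (besselJOrderDeriv μ x * Real.cos (μ * π) - besselJ μ x * (Real.sin (μ * π) * π)
        + besselJOrderDeriv (-μ) x) μ := by
  have h1 : HasDerivAt (fun μ : ℝ => Real.cos (μ * π)) (-Real.sin (μ * π) * π) μ := by
    simpa using ((hasDerivAt_id μ).mul_const π).cos
  have h2 := (hasDerivAt_besselJ_order hx (-μ)).comp μ (hasDerivAt_neg μ)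
  refine (((hasDerivAt_besselJ_order hx μ).mul h1).sub h2).congr_deriv ?_
  ring

theorem hasDerivAt_sin_mul_pi (μ : ℝ) :
    HasDerivAt (fun μ : ℝ => Real.sin (μ * π)) (Real.cos (μ * π) * π) μ := by
  simpa using ((hasDerivAt_id μ).mul_const π).sin

theorem tendsto_besselYQuot_of_mem {x : ℝ} (hx : 0 < x) {ν : ℝ} (hν : ν ∈ nonIntegers) :
    Tendsto (fun μ => besselYQuot μ x) (𝓝[nonIntegers] ν) (𝓝 (besselYQuot ν x)) :=
  (((hasDerivAt_besselYQuot_num hx ν).continuousAt.div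
    (hasDerivAt_sin_mul_pi ν).continuousAt (sin_mul_pi_ne_zero hν)).tendsto).mono_left
    nhdsWithin_le_nhds

theorem besselY_of_mem_nonIntegers {x : ℝ} (hx : 0 < x) {ν : ℝ} (hν : ν ∈ nonIntegers) :
    besselY ν x = besselYQuot ν x :=
  besselY_eq_of_tendsto (tendsto_besselYQuot_of_mem hx hν)

theorem cos_nat_mul_pi_sq (n : ℕ) : Real.cos (n * π) ^ 2 = 1 := by
  rw [Real.cos_sq', Real.sin_nat_mul_pi]
  norm_num

theorem tendsto_besselYQuot_nat {x : ℝ} (hx : 0 < x) (n : ℕ) :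
    Tendsto (fun μ => besselYQuot μ x) (𝓝[nonIntegers] (n : ℝ))
      (𝓝 ((besselJOrderDeriv n x + Real.cos (n * π) * besselJOrderDeriv (-n) x) / π)) := by
  have hc := cos_nat_mul_pi_sq n
  have hc0 : Real.cos (n * π) ≠ 0 := by
    intro h
    norm_num [h] at hc
  have h1 := (hasDerivAt_besselYQuot_num hx n).tendsto_slope
  have h2 := (hasDerivAt_sin_mul_pi n).tendsto_slope
  have h3 := h1.div h2 (mul_ne_zero hc0 Real.pi_ne_zero)
  have hle : 𝓝[nonIntegers] (n : ℝ) ≤ 𝓝[≠] (n : ℝ) :=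
    nhdsWithin_mono _ fun μ hμ => by simpa using hμ n
  have hval : (besselJOrderDeriv n x + Real.cos (n * π) * besselJOrderDeriv (-n) x) / π
      = (besselJOrderDeriv n x * Real.cos (n * π) - besselJ n x * (Real.sin (n * π) * π)
        + besselJOrderDeriv (-n) x) / (Real.cos (n * π) * π) := by
    rw [Real.sin_nat_mul_pi, div_eq_div_iff Real.pi_ne_zero (mul_ne_zero hc0 Real.pi_ne_zero)]
    linear_combination π * besselJOrderDeriv (-n) x * hc
  rw [hval]
  refine (h3.mono_left hle).congr' ?_
  filter_upwards [self_mem_nhdsWithin] with μ hμ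
  have hμn : μ - n ≠ 0 := sub_ne_zero.2 (by simpa using hμ n)
  simp only [Pi.div_apply, slope_def_field, besselYQuot]
  rw [besselJ_neg_nat hx, Real.sin_nat_mul_pi, mul_comm (besselJ n x), sub_self, sub_zero,
    sub_zero, div_div_div_cancel_right₀ hμn]

theorem besselY_nat {x : ℝ} (hx : 0 < x) (n : ℕ) :
    besselY n x
      = (besselJOrderDeriv n x + Real.cos (n * π) * besselJOrderDeriv (-n) x) / π :=
  besselY_eq_of_tendsto (tendsto_besselYQuot_nat hx n)

theorem mem_nonIntegers_or_eq_nat {ν : ℝ} (hν : 0 ≤ ν) :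
    ν ∈ nonIntegers ∨ ∃ n : ℕ, ν = n := by
  by_cases h : ν ∈ nonIntegers
  · exact Or.inl h
  · simp only [nonIntegers, Set.mem_ofPred_eq, not_forall, not_not] at h
    obtain ⟨m, rfl⟩ := h
    lift m to ℕ using by exact_mod_cast hν
    exact Or.inr ⟨m, by simp⟩

theorem tendsto_besselYQuot {x : ℝ} (hx : 0 < x) {ν : ℝ} (hν : 0 ≤ ν) :
    Tendsto (fun μ => besselYQuot μ x) (𝓝[nonIntegers] ν) (𝓝 (besselY ν x)) := by
  rcases mem_nonIntegers_or_eq_nat hν with h | ⟨n, rfl⟩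
  · rw [besselY_of_mem_nonIntegers hx h]
    exact tendsto_besselYQuot_of_mem hx h
  · rw [besselY_nat hx]
    exact tendsto_besselYQuot_nat hx n

theorem besselYQuot_add_one (μ x : ℝ) :
    besselYQuot (μ + 1) x
      = (besselJ (μ + 1) x * Real.cos (μ * π) + besselJ (-(μ + 1)) x) / Real.sin (μ * π) := by
  rw [besselYQuot, add_one_mul, Real.cos_add_pi, Real.sin_add_pi, div_neg, ← neg_div]
  ring

theorem besselYQuot_recurrence {x : ℝ} (hx : 0 < x) (μ : ℝ) :
    besselYQuot μ x + besselYQuot (μ + 1 + 1) x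
      = 2 * (μ + 1) / x * besselYQuot (μ + 1) x := by
  have e1 := besselJ_recurrence hx (μ + 1)
  have e2 := besselJ_recurrence hx (-(μ + 1))
  rw [add_sub_cancel_right] at e1
  rw [show -(μ + 1) - 1 = -(μ + 1 + 1) by ring, show -(μ + 1) + 1 = -μ by ring] at e2
  rw [besselYQuot_add_one (μ + 1), besselYQuot_add_one, besselYQuot, add_one_mul, Real.cos_add_pi,
    Real.sin_add_pi]
  linear_combination (Real.cos (μ * π) * e1 - e2) / Real.sin (μ * π)

theorem besselY_recurrence {x : ℝ} (hx : 0 < x) {ν : ℝ} (hν : 0 ≤ ν) :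
    besselY ν x + besselY (ν + 1 + 1) x = 2 * (ν + 1) / x * besselY (ν + 1) x := by
  have := neBot_nhdsWithin_nonIntegers ν
  have t1 := tendsto_add_one_nonIntegers ν
  have t2 := (tendsto_add_one_nonIntegers (ν + 1)).comp t1
  have h0 := tendsto_besselYQuot hx hν
  have h1 := (tendsto_besselYQuot hx (by linarith : 0 ≤ ν + 1)).comp t1
  have h2 := (tendsto_besselYQuot hx (by linarith : 0 ≤ ν + 1 + 1)).comp t2
  have hc : Tendsto (fun μ : ℝ => 2 * (μ + 1) / x) (𝓝[nonIntegers] ν) (𝓝 (2 * (ν + 1) / x)) :=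
    ((by fun_prop : Continuous fun μ : ℝ => 2 * (μ + 1) / x).tendsto ν).mono_left
      nhdsWithin_le_nhds
  exact tendsto_nhds_unique (h0.add h2)
    ((hc.mul h1).congr fun μ => (besselYQuot_recurrence hx μ).symm)

theorem besselJ_mul_besselYQuot_sub {x : ℝ} (hx : 0 < x) {μ : ℝ} (hμ : μ ∈ nonIntegers) :
    besselJ μ x * besselYQuot (μ + 1) x - besselJ (μ + 1) x * besselYQuot μ x
      = -2 / (π * x) := by
  have hs := sin_mul_pi_ne_zero hμ
  have h := besselJ_cross_product hx μ
  have hx0 := hx.ne'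
  have hpi := Real.pi_ne_zero
  rw [besselYQuot_add_one, besselYQuot]
  field_simp
  field_simp at h
  linear_combination h

theorem besselJ_mul_besselY_sub {x : ℝ} (hx : 0 < x) {ν : ℝ} (hν : 0 ≤ ν) :
    besselJ ν x * besselY (ν + 1) x - besselJ (ν + 1) x * besselY ν x = -2 / (π * x) := by
  have := neBot_nhdsWithin_nonIntegers ν
  have t1 := tendsto_add_one_nonIntegers ν
  have h0 := tendsto_besselYQuot hx hν
  have h1 := (tendsto_besselYQuot hx (by linarith : 0 ≤ ν + 1)).comp t1
  have j0 : Tendsto (fun μ => besselJ μ x) (𝓝[nonIntegers] ν) (𝓝 (besselJ ν x)) :=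
    (hasDerivAt_besselJ_order hx ν).continuousAt.tendsto.mono_left nhdsWithin_le_nhds
  have j1 : Tendsto (fun μ => besselJ (μ + 1) x) (𝓝[nonIntegers] ν) (𝓝 (besselJ (ν + 1) x)) :=
    ((hasDerivAt_besselJ_order hx (ν + 1)).continuousAt.tendsto.mono_left
      nhdsWithin_le_nhds).comp t1
  refine tendsto_nhds_unique ((j0.mul h1).sub (j1.mul h0)) (tendsto_const_nhds.congr' ?_)
  filter_upwards [self_mem_nhdsWithin] with μ hμ
  exact (besselJ_mul_besselYQuot_sub hx hμ).symm

theorem hasDerivAt_besselY {x : ℝ} (hx : 0 < x) {ν : ℝ} (hν : 0 ≤ ν) :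
    HasDerivAt (besselY ν) (ν / x * besselY ν x - besselY (ν + 1) x) x := by
  have hx0 := hx.ne'
  rcases mem_nonIntegers_or_eq_nat hν with h | ⟨n, rfl⟩
  · have hs := sin_mul_pi_ne_zero h
    have h1 : HasDerivAt (besselYQuot ν) (ν / x * besselY ν x - besselY (ν + 1) x) x := by
      refine ((((hasDerivAt_besselJ hx ν).mul_const (Real.cos (ν * π))).sub
        (hasDerivAt_besselJ hx (-ν))).div_const (Real.sin (ν * π))).congr_deriv ?_
      have e := besselJ_recurrence hx (-ν)
      rw [show -ν - 1 = -(ν + 1) by ring] at e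
      rw [besselY_of_mem_nonIntegers hx h,
        besselY_of_mem_nonIntegers hx (add_one_mem_nonIntegers h), besselYQuot_add_one, besselYQuot]
      linear_combination e / Real.sin (ν * π)
    refine h1.congr_of_eventuallyEq ?_
    filter_upwards [lt_mem_nhds hx] with y hy using besselY_of_mem_nonIntegers hy h
  · have h1 : HasDerivAt (fun x =>
        (besselJOrderDeriv n x + Real.cos (n * π) * besselJOrderDeriv (-n) x) / π)
        (n / x * besselY n x - besselY (n + 1) x) x := by
      refine (((hasDerivAt_besselJOrderDeriv hx n).add
        ((hasDerivAt_besselJOrderDeriv hx (-n)).const_mul (Real.cos (n * π)))).div_const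
        π).congr_deriv ?_
      have e := besselJOrderDeriv_recurrence hx (-n)
      rw [show -(n : ℝ) - 1 = -(n + 1) by ring] at e
      have e2 := besselY_nat hx (n + 1)
      push_cast at e2
      rw [e2, besselY_nat hx, add_one_mul, Real.cos_add_pi]
      have hc := cos_nat_mul_pi_sq n
      rw [besselJ_neg_nat hx] at e ⊢
      linear_combination -Real.cos (n * π) / π * e - besselJ n x / (x * π) * hc
    refine h1.congr_of_eventuallyEq ?_
    filter_upwards [lt_mem_nhds hx] with y hy using besselY_nat hy n

theorem hasDerivAt_besselY_add_one {x : ℝ} (hx : 0 < x) {ν : ℝ} (hν : 0 ≤ ν) :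
    HasDerivAt (besselY (ν + 1)) (besselY ν x - (ν + 1) / x * besselY (ν + 1) x) x := by
  refine (hasDerivAt_besselY hx (by linarith : 0 ≤ ν + 1)).congr_deriv ?_
  linear_combination -besselY_recurrence hx hν

theorem eventually_besselJ_mem {ν : ℝ} (hν : 0 ≤ ν) :
    ∃ C : ℝ, 0 < C ∧ ∀ᶠ x in 𝓝[>] (0 : ℝ), 0 < besselJ ν x ∧ besselJ ν x ≤ C := by
  have hpos : 0 < rGamma (ν + 1) := inv_pos.2 (Real.Gamma_pos_of_pos (by linarith))
  have hcont : Tendsto (fun x : ℝ => besselSeries rGamma (ν + 1) (x ^ 2 / 4)) (𝓝[>] 0)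
      (𝓝 (rGamma (ν + 1))) := by
    have h1 : ContinuousAt (besselSeries rGamma (ν + 1)) ((0 : ℝ) ^ 2 / 4) :=
      (hasDerivAt_besselSeries boundedOnRays_rGamma (ν + 1) _).continuousAt
    have h2 : ContinuousAt (fun x : ℝ => x ^ 2 / 4) 0 := by fun_prop
    have h3 := (ContinuousAt.comp (f := fun x : ℝ => x ^ 2 / 4) h1 h2).tendsto
    simp only [Function.comp_def] at h3
    rw [zero_pow two_ne_zero, zero_div, besselSeries_rGamma_zero] at h3
    exact h3.mono_left nhdsWithin_le_nhds
  refine ⟨2 * rGamma (ν + 1), by positivity, ?_⟩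
  filter_upwards [hcont.eventually (lt_mem_nhds hpos),
    hcont.eventually (gt_mem_nhds (by linarith : rGamma (ν + 1) < 2 * rGamma (ν + 1))),
    Ioo_mem_nhdsGT (zero_lt_two (α := ℝ))] with x h1 h2 h3
  have hx2 : 0 < x / 2 := by linarith [h3.1]
  rw [besselJ_eq h3.1]
  have hp := Real.rpow_pos_of_pos hx2 ν
  have hp1 : (x / 2) ^ ν ≤ 1 := Real.rpow_le_one hx2.le (by linarith [h3.2]) hν
  exact ⟨by positivity, by nlinarith⟩

theorem eventually_besselY_neg {ν : ℝ} (hν : 0 ≤ ν) : ∀ᶠ x in 𝓝[>] (0 : ℝ), besselY ν x < 0 := by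
  obtain ⟨C, hC, hev⟩ := eventually_besselJ_mem hν
  obtain ⟨δ, hδ : 0 < δ, hsub⟩ := (mem_nhdsGT_iff_exists_Ioo_subset).1 hev
  have hd : ∀ x ∈ Set.Ioo 0 δ, HasDerivAt
      (fun x => besselY ν x / besselJ ν x - 2 / (π * C ^ 2) * Real.log x)
      (2 / (π * x) / besselJ ν x ^ 2 - 2 / (π * C ^ 2) * x⁻¹) x := by
    intro x hx
    have hJ := (hsub hx).1.ne'
    refine (((hasDerivAt_besselY hx.1 hν).div (hasDerivAt_besselJ hx.1 ν) hJ).sub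
      ((Real.hasDerivAt_log hx.1.ne').const_mul _)).congr_deriv ?_
    congr 2
    have := besselJ_mul_besselY_sub hx.1 hν
    linear_combination -this
  have hmono : MonotoneOn (fun x => besselY ν x / besselJ ν x - 2 / (π * C ^ 2) * Real.log x)
      (Set.Ioo 0 δ) := by
    refine monotoneOn_of_deriv_nonneg (convex_Ioo 0 δ)
      (fun x hx => (hd x hx).continuousAt.continuousWithinAt)
      (fun x hx => (hd x (interior_subset hx)).differentiableAt.differentiableWithinAt)
      (fun x hx => ?_)
    rw [interior_Ioo] at hx
    obtain ⟨h1, h2⟩ := hsub hx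
    rw [(hd x hx).deriv, sub_nonneg, div_div, ← div_eq_mul_inv, div_div]
    have hx0 := hx.1
    have hpi := Real.pi_pos
    refine div_le_div_of_nonneg_left zero_le_two (by positivity) ?_
    rw [mul_right_comm]
    gcongr
  have hb : δ / 2 ∈ Set.Ioo 0 δ := ⟨by linarith, by linarith⟩
  have hlim : Tendsto (fun x => 2 / (π * C ^ 2) * Real.log x
      + (besselY ν (δ / 2) / besselJ ν (δ / 2) - 2 / (π * C ^ 2) * Real.log (δ / 2)))
      (𝓝[>] 0) atBot :=
    tendsto_atBot_add_const_right _ _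
      (Real.tendsto_log_nhdsGT_zero.const_mul_atBot (by positivity))
  filter_upwards [hlim.eventually (eventually_lt_atBot 0),
    Ioo_mem_nhdsGT (by linarith : 0 < δ / 2)] with x h1 h2
  have hx : x ∈ Set.Ioo 0 δ := ⟨h2.1, by linarith [h2.2]⟩
  have h3 := hmono hx hb h2.2.le
  simp only at h3
  have h4 : besselY ν x / besselJ ν x < 0 := by linarith
  simpa using (div_lt_iff₀ (hsub hx).1).1 h4

theorem besselY_ne_zero_or {ν : ℝ} (hν : 0 ≤ ν) {a : ℝ} (ha : 0 < a) :
    besselY ν a ≠ 0 ∨ besselY (ν + 1) a ≠ 0 := by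
  by_contra! h
  set E : ℝ → ℝ := fun x => x ^ (2 * (ν + 1)) * (besselY ν x ^ 2 + besselY (ν + 1) x ^ 2) with hE
  have hd : ∀ x, 0 < x → HasDerivAt E
      (x ^ (2 * (ν + 1)) / x * (2 * (2 * ν + 1) * besselY ν x ^ 2)) x := by
    intro x hx
    have h1 : HasDerivAt (fun x : ℝ => x ^ (2 * (ν + 1)))
        (2 * (ν + 1) * x ^ (2 * (ν + 1) - 1)) x :=
      Real.hasDerivAt_rpow_const (Or.inl hx.ne')
    refine (h1.mul (((hasDerivAt_besselY hx hν).pow 2).add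
      ((hasDerivAt_besselY_add_one hx hν).pow 2))).congr_deriv ?_
    rw [Real.rpow_sub_one hx.ne']
    simp only [Pi.add_apply, Pi.pow_apply]
    push_cast
    field_simp
    ring
  have hmono : MonotoneOn E (Set.Ioi 0) := by
    refine monotoneOn_of_deriv_nonneg (convex_Ioi 0)
      (fun x hx => (hd x hx).continuousAt.continuousWithinAt)
      (fun x hx => (hd x (interior_subset hx)).differentiableAt.differentiableWithinAt)
      (fun x hx => ?_)
    rw [interior_Ioi] at hx
    have hx0 : 0 < x := hx
    rw [(hd x hx).deriv]
    positivity
  obtain ⟨x, hneg, hx⟩ := ((eventually_besselY_neg hν).and (Ioo_mem_nhdsGT ha)).exists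
  have h1 := hmono hx.1 ha hx.2.le
  simp only [hE, h.1, h.2] at h1
  have h2 : 0 < x ^ (2 * (ν + 1)) := Real.rpow_pos_of_pos hx.1 _
  nlinarith [sq_nonneg (besselY (ν + 1) x), mul_pos h2 (pow_pos (neg_pos.2 hneg) 2),
    mul_nonneg h2.le (sq_nonneg (besselY (ν + 1) x))]

theorem hasDerivAt_besselY_mul {ν : ℝ} (hν : 0 ≤ ν) {x : ℝ} (hx : 0 < x) :
    HasDerivAt (fun x => besselY ν x * besselY (ν + 1) x)
      (besselY ν x ^ 2 - besselY (ν + 1) x ^ 2 - besselY ν x * besselY (ν + 1) x / x) x := by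
  refine ((hasDerivAt_besselY hx hν).mul (hasDerivAt_besselY_add_one hx hν)).congr_deriv ?_
  ring

theorem neg_of_ne_zero_of_neg {P : ℝ → ℝ} {a b : ℝ} (hP : ContinuousOn P (Set.Ioo a b))
    (h0 : ∀ x ∈ Set.Ioo a b, P x ≠ 0) {c : ℝ} (hc : c ∈ Set.Ioo a b) (hPc : P c < 0) :
    ∀ x ∈ Set.Ioo a b, P x < 0 := by
  intro x hx
  by_contra! h
  obtain ⟨z, hz, hz0⟩ := isPreconnected_Ioo.intermediate_value hc hx hP ⟨hPc.le, h⟩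
  exact h0 z hz hz0

theorem neg_on_Ioo_of_hasDerivAt_left {P : ℝ → ℝ} {a b p : ℝ} (hP : ContinuousOn P (Set.Ioo a b))
    (h0 : ∀ x ∈ Set.Ioo a b, P x ≠ 0) (ha : P a = 0) (hd : HasDerivAt P p a) (hp : p < 0) :
    ∀ x ∈ Set.Ioo a b, P x < 0 := by
  intro x hx
  have h1 : ∀ᶠ y in 𝓝[>] a, slope P a y < 0 :=
    (hd.tendsto_slope.mono_left (nhdsWithin_mono _ fun y (hy : a < y) => hy.ne')).eventually
      (gt_mem_nhds hp)
  obtain ⟨c, hc, hcab⟩ := (h1.and (Ioo_mem_nhdsGT (hx.1.trans hx.2))).exists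
  rw [slope_def_field, ha, sub_zero, div_lt_iff₀ (sub_pos.2 hcab.1), zero_mul] at hc
  exact neg_of_ne_zero_of_neg hP h0 hcab hc x hx

theorem neg_on_Ioo_of_hasDerivAt_right {P : ℝ → ℝ} {a b p : ℝ} (hP : ContinuousOn P (Set.Ioo a b))
    (h0 : ∀ x ∈ Set.Ioo a b, P x ≠ 0) (hb : P b = 0) (hd : HasDerivAt P p b) (hp : 0 < p) :
    ∀ x ∈ Set.Ioo a b, P x < 0 := by
  intro x hx
  have h1 : ∀ᶠ y in 𝓝[<] b, 0 < slope P b y :=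
    (hd.tendsto_slope.mono_left (nhdsWithin_mono _ fun y (hy : y < b) => hy.ne)).eventually
      (lt_mem_nhds hp)
  obtain ⟨c, hc, hcab⟩ := (h1.and (Ioo_mem_nhdsLT (hx.1.trans hx.2))).exists
  rw [slope_def_field, hb, sub_zero] at hc
  have : P c < 0 := by
    by_contra! h
    exact absurd (div_nonpos_of_nonneg_of_nonpos h (sub_neg.2 hcab.2).le) (not_le.2 hc)
  exact neg_of_ne_zero_of_neg hP h0 hcab this x hx

section

variable {ν a b : ℝ}

theorem continuousOn_besselY_mul (hν : 0 ≤ ν) (ha : 0 ≤ a) :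
    ContinuousOn (fun x => besselY ν x * besselY (ν + 1) x) (Set.Ioo a b) := fun _ hx =>
  (hasDerivAt_besselY_mul hν (ha.trans_lt hx.1)).continuousAt.continuousWithinAt

theorem besselY_mul_neg_of_left (hν : 0 ≤ ν) (ha : 0 < a) (hz : besselY ν a = 0)
    (h0 : ∀ x ∈ Set.Ioo a b, besselY ν x * besselY (ν + 1) x ≠ 0) :
    ∀ x ∈ Set.Ioo a b, besselY ν x * besselY (ν + 1) x < 0 := by
  have h1 := (besselY_ne_zero_or hν ha).resolve_left (not_not.2 hz)
  refine neg_on_Ioo_of_hasDerivAt_left (continuousOn_besselY_mul hν ha.le) h0 (by simp [hz])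
    (hasDerivAt_besselY_mul hν ha) ?_
  rw [hz]
  simpa using pow_pos (abs_pos.2 h1) 2

theorem besselY_mul_pos_of_left (hν : 0 ≤ ν) (ha : 0 < a) (hz : besselY (ν + 1) a = 0)
    (h0 : ∀ x ∈ Set.Ioo a b, besselY ν x * besselY (ν + 1) x ≠ 0) :
    ∀ x ∈ Set.Ioo a b, 0 < besselY ν x * besselY (ν + 1) x := by
  have h1 := (besselY_ne_zero_or hν ha).resolve_right (not_not.2 hz)
  have := neg_on_Ioo_of_hasDerivAt_left (continuousOn_besselY_mul hν ha.le).neg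
    (fun x hx => neg_ne_zero.2 (h0 x hx)) (by simp [hz]) (hasDerivAt_besselY_mul hν ha).neg
    (by rw [hz]; simpa using pow_pos (abs_pos.2 h1) 2)
  exact fun x hx => neg_lt_zero.1 (this x hx)

theorem besselY_mul_pos_of_right (hν : 0 ≤ ν) (ha : 0 ≤ a) (hb : 0 < b) (hz : besselY ν b = 0)
    (h0 : ∀ x ∈ Set.Ioo a b, besselY ν x * besselY (ν + 1) x ≠ 0) :
    ∀ x ∈ Set.Ioo a b, 0 < besselY ν x * besselY (ν + 1) x := by
  have h1 := (besselY_ne_zero_or hν hb).resolve_left (not_not.2 hz)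
  have := neg_on_Ioo_of_hasDerivAt_right (continuousOn_besselY_mul hν ha).neg
    (fun x hx => neg_ne_zero.2 (h0 x hx)) (by simp [hz]) (hasDerivAt_besselY_mul hν hb).neg
    (by rw [hz]; simpa using pow_pos (abs_pos.2 h1) 2)
  exact fun x hx => neg_lt_zero.1 (this x hx)

theorem besselY_mul_neg_of_right (hν : 0 ≤ ν) (ha : 0 ≤ a) (hb : 0 < b)
    (hz : besselY (ν + 1) b = 0)
    (h0 : ∀ x ∈ Set.Ioo a b, besselY ν x * besselY (ν + 1) x ≠ 0) :
    ∀ x ∈ Set.Ioo a b, besselY ν x * besselY (ν + 1) x < 0 := by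
  have h1 := (besselY_ne_zero_or hν hb).resolve_right (not_not.2 hz)
  refine neg_on_Ioo_of_hasDerivAt_right (continuousOn_besselY_mul hν ha) h0 (by simp [hz])
    (hasDerivAt_besselY_mul hν hb) ?_
  rw [hz]
  simpa using pow_pos (abs_pos.2 h1) 2

end

namespace IsPosZeroSeq

variable {f : ℝ → ℝ} {z : ℕ → ℝ}

theorem lt_iff (h : IsPosZeroSeq f z) {s t : ℕ} (hs : 1 ≤ s) (ht : 1 ≤ t) :
    z s < z t ↔ s < t := by
  refine ⟨fun hlt => ?_, h.mono s t hs⟩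
  by_contra! hle
  rcases hle.eq_or_lt with rfl | hlt'
  · exact lt_irrefl _ hlt
  · exact lt_asymm hlt (h.mono t s ht hlt')

theorem ne_zero_of_lt_first (h : IsPosZeroSeq f z) {x : ℝ} (hx : 0 < x) (hx1 : x < z 1) :
    f x ≠ 0 := by
  intro h0
  obtain ⟨s, hs, rfl⟩ := h.complete x hx h0
  have := (h.lt_iff hs le_rfl).1 hx1
  omega

theorem ne_zero_of_between (h : IsPosZeroSeq f z) {s : ℕ} (hs : 1 ≤ s) {x : ℝ} (hx : z s < x)
    (hx1 : x < z (s + 1)) : f x ≠ 0 := by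
  intro h0
  obtain ⟨t, ht, rfl⟩ := h.complete x ((h.pos s hs).trans hx) h0
  have h1 := (h.lt_iff hs ht).1 hx
  have h2 := (h.lt_iff ht (by omega)).1 hx1
  omega

end IsPosZeroSeq

/-- The positive zeros of `Y_ν` and `Y_{ν+1}` interlace. -/
theorem besselY_zeros_interlace {ν : ℝ} (hν : 0 ≤ ν) {y y1 : ℕ → ℝ}
    (hy : IsPosZeroSeq (besselY ν) y) (hy1 : IsPosZeroSeq (besselY (ν + 1)) y1) :
    ∀ s : ℕ, 1 ≤ s → y s < y1 s ∧ y1 s < y (s + 1) := by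
  have hne : ∀ s t, 1 ≤ s → 1 ≤ t → y s ≠ y1 t := by
    intro s t hs ht he
    have h1 := hy1.isZero t ht
    rw [← he] at h1
    exact (besselY_ne_zero_or hν (hy.pos s hs)).elim (· (hy.isZero s hs)) (· h1)
  have base : y 1 < y1 1 := by
    by_contra! hle
    have hlt := hle.lt_of_ne (hne 1 1 le_rfl le_rfl).symm
    have hneg := besselY_mul_neg_of_right hν le_rfl (hy1.pos 1 le_rfl) (hy1.isZero 1 le_rfl)
      (fun x hx => mul_ne_zero (hy.ne_zero_of_lt_first hx.1 (hx.2.trans hlt))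
        (hy1.ne_zero_of_lt_first hx.1 hx.2))
    obtain ⟨x, ⟨hf, hg⟩, hx⟩ := (((eventually_besselY_neg hν).and
      (eventually_besselY_neg (by linarith : 0 ≤ ν + 1))).and
      (Ioo_mem_nhdsGT (hy1.pos 1 le_rfl))).exists
    exact lt_asymm (hneg x hx) (mul_pos_of_neg_of_neg hf hg)
  have step1 : ∀ s, 1 ≤ s → y s < y1 s →
      (∀ x, y s < x → x < y1 s → besselY (ν + 1) x ≠ 0) → y1 s < y (s + 1) := by
    intro s hs hlt hn
    by_contra! hle
    have hlt' := hle.lt_of_ne (hne (s + 1) s (by omega) hs)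
    have h0 : ∀ x ∈ Set.Ioo (y s) (y (s + 1)), besselY ν x * besselY (ν + 1) x ≠ 0 :=
      fun x hx => mul_ne_zero (hy.ne_zero_of_between hs hx.1 hx.2) (hn x hx.1 (hx.2.trans hlt'))
    obtain ⟨x, hx⟩ := exists_between (hy.mono s (s + 1) hs (by omega))
    exact lt_asymm (besselY_mul_neg_of_left hν (hy.pos s hs) (hy.isZero s hs) h0 x hx)
      (besselY_mul_pos_of_right hν (hy.pos s hs).le (hy.pos _ (by omega))
        (hy.isZero _ (by omega)) h0 x hx)
  intro s hs
  induction s, hs using Nat.le_induction with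
  | base =>
    exact ⟨base, step1 1 le_rfl base fun x hx hx1 =>
      hy1.ne_zero_of_lt_first ((hy.pos 1 le_rfl).trans hx) hx1⟩
  | succ s hs ih =>
    obtain ⟨ih1, ih2⟩ := ih
    have hlt : y (s + 1) < y1 (s + 1) := by
      by_contra! hle
      have hlt' := hle.lt_of_ne (hne (s + 1) (s + 1) (by omega) (by omega)).symm
      have h0 : ∀ x ∈ Set.Ioo (y1 s) (y1 (s + 1)), besselY ν x * besselY (ν + 1) x ≠ 0 :=
        fun x hx => mul_ne_zero (hy.ne_zero_of_between hs (ih1.trans hx.1) (hx.2.trans hlt'))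
          (hy1.ne_zero_of_between hs hx.1 hx.2)
      obtain ⟨x, hx⟩ := exists_between (hy1.mono s (s + 1) hs (by omega))
      exact lt_asymm (besselY_mul_neg_of_right hν (hy1.pos s hs).le (hy1.pos _ (by omega))
        (hy1.isZero _ (by omega)) h0 x hx)
        (besselY_mul_pos_of_left hν (hy1.pos s hs) (hy1.isZero s hs) h0 x hx)
    exact ⟨hlt, step1 (s + 1) (by omega) hlt fun x hx hx1 =>
      hy1.ne_zero_of_between hs (ih2.trans hx) hx1⟩

/-- Sign coincidence and sign difference of `Y_ν` and `Y_{ν+1}`: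
`Y_ν(x)·Y_{ν+1}(x) > 0` on `(y_{ν+1,s}, y_{ν,s+1})` and
`Y_ν(x)·Y_{ν+1}(x) < 0` on `(y_{ν,s}, y_{ν+1,s})`. -/
theorem besselY_sign_intervals (ν : ℝ) (hν : 0 ≤ ν)
    (y y1 : ℕ → ℝ)
    (hy : IsPosZeroSeq (besselY ν) y)
    (hy1 : IsPosZeroSeq (besselY (ν + 1)) y1) :
    ∀ s : ℕ, 1 ≤ s →
      (∀ x : ℝ, y1 s < x → x < y (s + 1) →
        0 < besselY ν x * besselY (ν + 1) x) ∧
      (∀ x : ℝ, y s < x → x < y1 s →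
        besselY ν x * besselY (ν + 1) x < 0) := by
  intro s hs
  obtain ⟨h1, h2⟩ := besselY_zeros_interlace hν hy hy1 s hs
  refine ⟨fun x hx hx' => ?_, fun x hx hx' => ?_⟩
  · refine besselY_mul_pos_of_left hν (hy1.pos s hs) (hy1.isZero s hs) (fun z hz => ?_) x ⟨hx, hx'⟩
    have h3 := (besselY_zeros_interlace hν hy hy1 (s + 1) (by omega)).1
    exact mul_ne_zero (hy.ne_zero_of_between hs (h1.trans hz.1) hz.2)
      (hy1.ne_zero_of_between hs hz.1 (hz.2.trans h3))
  · refine besselY_mul_neg_of_left hν (hy.pos s hs) (hy.isZero s hs) (fun z hz => ?_) x ⟨hx, hx'⟩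
    refine mul_ne_zero (hy.ne_zero_of_between hs hz.1 (hz.2.trans h2)) ?_
    rcases hs.eq_or_lt with rfl | hs'
    · exact hy1.ne_zero_of_lt_first ((hy.pos 1 le_rfl).trans hz.1) hz.2
    · obtain ⟨r, rfl⟩ : ∃ r, s = r + 1 := ⟨s - 1, by omega⟩
      have h3 := (besselY_zeros_interlace hν hy hy1 r (by omega)).2
      exact hy1.ne_zero_of_between (by omega) (h3.trans hz.1) hz.2
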